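/- arXiv:2306.08250 — 2 statements merged into one kernel-verified Lean document; each statement's English description precedes it below -/
import Mathlib

section
/- Let (p,q) be a pair of nonzero integers with p q < 0. Then the group G_{p,q} admits a generalized torsion element. -/
/-- The set of conjugates `h⁻¹ * g * h` of an element `g` of a group. -/
def conjSet {G : Type*} [Group G] (g : G) : Set G := {x | ∃ h : G, x = h⁻¹ * g * h}

/-- `<<g>>^+`: the subsemigroup generated by all conjugates of `g`. -/
def ggP {G : Type*} [Group G] (g : G) : Subsemigroup G := Subsemigroup.closure (conjSet g)

/-- A generalized torsion element: a nontrivial element `g` with `1 ∈ <<g>>^+`. -/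
def IsGenTorsionElem {G : Type*} [Group G] (g : G) : Prop := g ≠ 1 ∧ (1 : G) ∈ ggP g

/-- `G` admits a generalized torsion element. -/
def HasGenTorsion (G : Type*) [Group G] : Prop := ∃ g : G, IsGenTorsionElem g

/-- The relators of the presentation
`< a, b, t | t a^p t⁻¹ = b⁻¹ a^p, t b^{-q} a⁻¹ t⁻¹ = b^{-q}, [b^q, a^p] = 1 >`,
where `a`, `b`, `t` are the generators `0`, `1`, `2` respectively, and
`[g,h] = g⁻¹ h⁻¹ g h`. -/
def gpqRels (p q : ℤ) : Set (FreeGroup (Fin 3)) :=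
  let a : FreeGroup (Fin 3) := FreeGroup.of 0
  let b : FreeGroup (Fin 3) := FreeGroup.of 1
  let t : FreeGroup (Fin 3) := FreeGroup.of 2
  { t * a ^ p * t⁻¹ * (b⁻¹ * a ^ p)⁻¹,
    t * b ^ (-q) * a⁻¹ * t⁻¹ * (b ^ (-q))⁻¹,
    (b ^ q)⁻¹ * (a ^ p)⁻¹ * b ^ q * a ^ p }

/-- `G_{p,q}`, the fundamental group of the 3-manifold obtained by 0-surgery along the
double twist knot `K_{p,q}`. -/
abbrev Gpq (p q : ℤ) := PresentedGroup (gpqRels p q)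

open scoped commutatorElement

section GeneralizedTorsion

variable {G : Type*} [Group G]

theorem self_mem_ggP (g : G) : g ∈ ggP g :=
  Subsemigroup.subset_closure ⟨1, by simp⟩

theorem conj_mem_ggP {g x : G} (hx : x ∈ ggP g) (h : G) : h * x * h⁻¹ ∈ ggP g := by
  induction hx using Subsemigroup.closure_induction with
  | mem x hx =>
    obtain ⟨k, rfl⟩ := hx
    exact Subsemigroup.subset_closure ⟨k * h⁻¹, by group⟩
  | mul x y _ _ hx hy =>
    have : h * (x * y) * h⁻¹ = h * x * h⁻¹ * (h * y * h⁻¹) := by group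
    rw [this]
    exact mul_mem hx hy

theorem ggP_le {g x : G} (hx : x ∈ ggP g) : ggP x ≤ ggP g := by
  refine (Subsemigroup.closure_le).2 ?_
  rintro _ ⟨h, rfl⟩
  simpa using conj_mem_ggP hx h⁻¹

theorem pow_mem_of_pos {S : Subsemigroup G} {x : G} (hx : x ∈ S) {n : ℕ} (hn : 0 < n) :
    x ^ n ∈ S := by
  induction n, hn using Nat.le_induction with
  | base => simpa using hx
  | succ n _ ih => rw [pow_succ]; exact mul_mem ih hx

theorem zpow_mem_of_pos {S : Subsemigroup G} {x : G} (hx : x ∈ S) {n : ℤ} (hn : 0 < n) :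
    x ^ n ∈ S := by
  lift n to ℕ using hn.le
  rw [zpow_natCast]
  exact pow_mem_of_pos hx (by exact_mod_cast hn)

theorem commutator_pow_left_mem_ggP {c g h : G} (hc : ⁅g, h⁆ ∈ ggP c) {n : ℕ} (hn : 0 < n) :
    ⁅g ^ n, h⁆ ∈ ggP c := by
  induction n, hn using Nat.le_induction with
  | base => simpa using hc
  | succ n _ ih =>
    have : ⁅g ^ (n + 1), h⁆ = g * ⁅g ^ n, h⁆ * g⁻¹ * ⁅g, h⁆ := by
      rw [pow_succ']
      simp only [commutatorElement_def]
      group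
    rw [this]
    exact mul_mem (conj_mem_ggP ih g) hc

theorem commutator_pow_right_mem_ggP {c g h : G} (hc : ⁅g, h⁆ ∈ ggP c) {n : ℕ} (hn : 0 < n) :
    ⁅g, h ^ n⁆ ∈ ggP c := by
  induction n, hn using Nat.le_induction with
  | base => simpa using hc
  | succ n _ ih =>
    have : ⁅g, h ^ (n + 1)⁆ = ⁅g, h⁆ * (h * ⁅g, h ^ n⁆ * h⁻¹) := by
      rw [pow_succ']
      simp only [commutatorElement_def]
      group
    rw [this]
    exact mul_mem hc (conj_mem_ggP ih h)

theorem Commute.pow_natAbs_of_zpow {g h : G} {n : ℤ} (H : Commute (g ^ n) h) :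
    Commute (g ^ n.natAbs) h := by
  rcases Int.natAbs_eq n with hn | hn
  · rwa [hn, zpow_natCast] at H
  · rwa [hn, zpow_neg, zpow_natCast, Commute.inv_left_iff] at H

/-- If nonzero powers of two elements commute, then the commutator of these elements is either
trivial or a generalized torsion element. -/
theorem one_mem_ggP_commutator {g h : G} {m n : ℤ} (hm : m ≠ 0) (hn : n ≠ 0)
    (H : Commute (g ^ m) (h ^ n)) : (1 : G) ∈ ggP ⁅g, h⁆ := by
  have H' := H.pow_natAbs_of_zpow.symm.pow_natAbs_of_zpow.symm
  rw [← commutatorElement_eq_one_iff_commute.2 H']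
  exact commutator_pow_right_mem_ggP
    (commutator_pow_left_mem_ggP (self_mem_ggP _) (Int.natAbs_pos.2 hm)) (Int.natAbs_pos.2 hn)

/-- If conjugation by `t` acts on the images of `X` and `Y` with characteristic polynomial
`k T ^ 2 - (2 k - 1) T + k`, which has no positive real root, then `1` is a product of
conjugates of `X`. -/
theorem one_mem_ggP_of_conj {X Y t : G} {k : ℤ} (hk : 0 < k) (hXY : Commute X Y)
    (hX : t * X * t⁻¹ = Y) (hY : (t * Y * t⁻¹) ^ k = Y ^ (2 * k - 1) * X ^ (-k)) :
    (1 : G) ∈ ggP X := by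
  by_contra hone
  have hYmem : Y ∈ ggP X := hX ▸ conj_mem_ggP (self_mem_ggP X) t
  have step (α β : ℤ) (hβ : 0 < β) (h : X ^ (-α) * Y ^ β ∈ ggP X) :
      X ^ (-(k * β)) * Y ^ ((2 * k - 1) * β - k * α) ∈ ggP X ∧
        0 < (2 * k - 1) * β - k * α := by
    have hmem : X ^ (-(k * β)) * Y ^ ((2 * k - 1) * β - k * α) ∈ ggP X := by
      have h1 := conj_mem_ggP (zpow_mem_of_pos h hk) t
      have h2 : Commute Y (t * Y * t⁻¹) := by
        have := hXY.map (MulAut.conj t)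
        simpa [hX] using this
      have h3 : t * (X ^ (-α) * Y ^ β) ^ k * t⁻¹ =
          X ^ (-(k * β)) * Y ^ ((2 * k - 1) * β - k * α) := by
        calc t * (X ^ (-α) * Y ^ β) ^ k * t⁻¹
            = MulAut.conj t ((X ^ (-α) * Y ^ β) ^ k) := by simp
          _ = (Y ^ (-α) * (t * Y * t⁻¹) ^ β) ^ k := by
              rw [map_zpow, map_mul, map_zpow, map_zpow, MulAut.conj_apply, MulAut.conj_apply, hX]
          _ = Y ^ (-(k * α)) * ((t * Y * t⁻¹) ^ k) ^ β := by
              rw [(h2.zpow_zpow _ _).mul_zpow, ← zpow_mul, ← zpow_mul, ← zpow_mul]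
              ring_nf
          _ = Y ^ (-(k * α)) * (Y ^ ((2 * k - 1) * β) * X ^ (-(k * β))) := by
              rw [hY, (hXY.symm.zpow_zpow _ _).mul_zpow, ← zpow_mul, ← zpow_mul]
              ring_nf
          _ = Y ^ ((2 * k - 1) * β - k * α) * X ^ (-(k * β)) := by
              rw [← mul_assoc, ← zpow_add]
              ring_nf
          _ = _ := (hXY.symm.zpow_zpow _ _).eq
      rwa [h3] at h1
    refine ⟨hmem, ?_⟩
    by_contra! hle
    have hXβ : X ^ (k * β) ∈ ggP X := zpow_mem_of_pos (self_mem_ggP X) (mul_pos hk hβ)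
    have h4 := mul_mem hXβ hmem
    rw [← mul_assoc, ← zpow_add, add_neg_cancel, zpow_zero, one_mul] at h4
    rcases hle.eq_or_lt with h0 | h0
    · rw [h0, zpow_zero] at h4
      exact hone h4
    · have h5 := mul_mem h4 (zpow_mem_of_pos hYmem (neg_pos.2 h0))
      rw [← zpow_add, add_neg_cancel, zpow_zero] at h5
      exact hone h5
  have descent (j : ℕ) : ∃ α β : ℤ, 0 < α ∧ 0 < β ∧ X ^ (-α) * Y ^ β ∈ ggP X ∧
      k * β ≤ (2 * k - (j + 1)) * α := by
    induction j with
    | zero =>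
      obtain ⟨h1, h2⟩ := step 0 1 one_pos (by simpa using hYmem)
      refine ⟨_, _, mul_pos hk one_pos, h2, h1, le_of_eq ?_⟩
      push_cast
      ring
    | succ j ih =>
      obtain ⟨α, β, hα, hβ, h, hle⟩ := ih
      obtain ⟨h1, h2⟩ := step α β hβ h
      refine ⟨_, _, mul_pos hk hβ, h2, h1, ?_⟩
      push_cast
      have key : ((j : ℤ) + 1) * β ≤ k * α := by
        refine le_of_mul_le_mul_left ?_ hk
        have h3 := mul_le_mul_of_nonneg_left hle (by positivity : (0 : ℤ) ≤ j + 1)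
        have h4 := mul_nonneg (sq_nonneg (k - (j + 1) : ℤ)) hα.le
        nlinarith
      have := mul_le_mul_of_nonneg_left key hk.le
      nlinarith
  obtain ⟨α, β, hα, hβ, -, hle⟩ := descent (2 * k).toNat
  rw [Int.toNat_of_nonneg (by positivity)] at hle
  nlinarith [mul_pos hk hβ]

theorem one_mem_ggP_of_commute {a b t : G} {p q : ℤ} (hpq : p * q < 0) (hab : Commute a b)
    (h₁ : t * a ^ p * t⁻¹ = b⁻¹ * a ^ p) (h₂ : t * b ^ (-q) * a⁻¹ * t⁻¹ = b ^ (-q)) :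
    (1 : G) ∈ ggP a := by
  have hk : 0 < -(p * q) := neg_pos.2 hpq
  have hmul (i j i' j' : ℤ) : a ^ i * b ^ j * (a ^ i' * b ^ j') = a ^ (i + i') * b ^ (j + j') := by
    rw [zpow_add, zpow_add, mul_assoc, ← mul_assoc (b ^ j), ← (hab.zpow_zpow i' j).eq]
    simp only [mul_assoc]
  have hpow (i j n : ℤ) : (a ^ i * b ^ j) ^ n = a ^ (i * n) * b ^ (j * n) := by
    rw [(hab.zpow_zpow i j).mul_zpow, zpow_mul, zpow_mul]
  set T := MulAut.conj t with hT
  have e₁ : T (a ^ p) = a ^ p * b ^ (-1 : ℤ) := by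
    rw [MulAut.conj_apply, h₁, zpow_neg_one, (hab.inv_right.zpow_left p).eq]
  have e₂ : T (a * b ^ q) = b ^ q := by
    have := congrArg (·⁻¹) h₂
    simp only [zpow_neg, mul_inv_rev, inv_inv] at this
    rw [MulAut.conj_apply]
    refine Eq.trans ?_ this
    simp only [mul_assoc]
  have e₃ : T (b ^ (p * q)) = a ^ (-p) * b ^ (p * q + 1) := by
    have h3 : b ^ (p * q) = (a ^ p)⁻¹ * (a * b ^ q) ^ p := by
      have := hpow 1 q p
      rw [zpow_one] at this
      rw [this, one_mul, mul_comm q p]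
      group
    rw [h3, map_mul, map_inv, e₁, map_zpow, e₂, ← zpow_neg_one (a ^ p * _), hpow, ← zpow_mul]
    have h5 := hmul (p * -1) (-1 * -1) 0 (q * p)
    rw [zpow_zero, one_mul] at h5
    rw [h5]
    ring_nf
  have eX : T (a ^ (-(p * q))) = a ^ (-(p * q)) * b ^ q := by
    rw [← mul_neg, zpow_mul, map_zpow, e₁, hpow, ← zpow_mul]
    ring_nf
  refine ggP_le (zpow_mem_of_pos (self_mem_ggP a) hk)
    (one_mem_ggP_of_conj (t := t) hk ?_ eX ?_)
  · exact (Commute.refl _).mul_right (hab.zpow_zpow _ _)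
  · have e₄ : T (b ^ q) ^ (-(p * q)) = a ^ (p * q) * b ^ (q * (-(p * q) - 1)) := by
      have : T (b ^ q) ^ (-(p * q)) = T (b ^ (p * q)) ^ (-q) := by
        rw [← map_zpow, ← map_zpow, ← zpow_mul, ← zpow_mul]
        ring_nf
      rw [this, e₃, hpow]
      ring_nf
    have hc : Commute (T (a ^ (-(p * q)))) (T (b ^ q)) := (hab.zpow_zpow _ _).map T
    have e₅ := hmul (-(p * q) * (2 * -(p * q) - 1)) (q * (2 * -(p * q) - 1))
      (-(p * q) * -(-(p * q))) 0
    rw [zpow_zero, mul_one] at e₅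
    rw [← MulAut.conj_apply, ← hT, map_mul, hc.mul_zpow, e₄, eX, hpow, hmul, hpow,
      ← zpow_mul, e₅]
    ring_nf

end GeneralizedTorsion

/-- The class of the generator `a` is nontrivial: it acts as a nontrivial translation in an
affine action of `G_{p,q}` on `ℂ`. -/
theorem Gpq.of_zero_ne_one {p q : ℤ} (hp : p ≠ 0) (hq : q ≠ 0) :
    (PresentedGroup.of 0 : Gpq p q) ≠ 1 := by
  obtain ⟨l, hl⟩ : ∃ l : ℂ, p * q * (l - 1) ^ 2 = l := by
    have hpq : (p * q : ℂ) ≠ 0 := by exact_mod_cast mul_ne_zero hp hq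
    obtain ⟨l, hl⟩ := exists_quadratic_eq_zero (b := -(2 * (p * q : ℂ) + 1)) (c := p * q) hpq
      (IsAlgClosed.exists_eq_mul_self _)
    exact ⟨l, by linear_combination hl⟩
  have hl0 : l ≠ 0 := by
    rintro rfl
    have : (p * q : ℂ) ≠ 0 := by exact_mod_cast mul_ne_zero hp hq
    simp_all
  let f : Fin 3 → Equiv.Perm ℂ :=
    ![Equiv.addRight 1, Equiv.addRight (p * (1 - l)), Equiv.mulLeft₀ l hl0]
  have hf : ∀ r ∈ gpqRels p q, FreeGroup.lift f r = 1 := by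
    rintro r (rfl | rfl | rfl)
    · simp [f]
      ext z
      simp
      field_simp
      ring
    · simp [f]
      ext z
      simp
      field_simp
      linear_combination hl
    · simp [f]
      ext z
      simp
  intro h
  have h1 := congrArg (PresentedGroup.toGroup hf) h
  rw [PresentedGroup.toGroup.of, map_one] at h1
  have h2 := Equiv.congr_fun h1 0
  simp [f] at h2

/-- if `pq < 0`, then `G_{p,q}` admits a generalized torsion element. -/
theorem hasGenTorsion_of_neg (p q : ℤ) (hp : p ≠ 0) (hq : q ≠ 0)
    (hpq : p * q < 0) : HasGenTorsion (Gpq p q) := by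
  let φ := PresentedGroup.mk (gpqRels p q)
  have rel {r : FreeGroup (Fin 3)} (hr : r ∈ gpqRels p q) : φ r = 1 :=
    PresentedGroup.one_of_mem hr
  have h₁ := rel (Or.inl rfl)
  have h₂ := rel (Or.inr (Or.inl rfl))
  have h₃ := rel (Or.inr (Or.inr rfl))
  simp only [map_mul, map_inv, map_zpow] at h₁ h₂ h₃
  have hcomm : Commute (φ (.of 0) ^ p) (φ (.of 1) ^ q) := by
    have : (φ (.of 0) ^ p * φ (.of 1) ^ q)⁻¹ * (φ (.of 1) ^ q * φ (.of 0) ^ p) = 1 := by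
      rw [← h₃]
      group
    exact inv_mul_eq_one.1 this
  by_cases hab : Commute (φ (.of 0)) (φ (.of 1))
  · exact ⟨φ (.of 0), Gpq.of_zero_ne_one hp hq,
      one_mem_ggP_of_commute hpq hab (mul_inv_eq_one.1 h₁) (mul_inv_eq_one.1 h₂)⟩
  · exact ⟨⁅φ (.of 0), φ (.of 1)⁆, fun h => hab (commutatorElement_eq_one_iff_commute.1 h),
      one_mem_ggP_commutator hp hq hcomm⟩
end

section
/- Let p and q be positive integers and suppose the group G_{p,q} admits no generalized torsion elements. Then for every integer n, the relation [b, t^{-n} b t^{n}] = 1 holds in G_{p,q}, where b and t denote the images of the generators. -/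
theorem pow_mul_pow_mem_ggP {G : Type*} [Group G] (z y : G) (m : ℕ) :
    z ^ (m + 1) * y ^ (m + 1) ∈ ggP (z * y) := by
  have hconj (h : G) : h⁻¹ * (z * y) * h ∈ ggP (z * y) := Subsemigroup.subset_closure ⟨h, rfl⟩
  induction m with
  | zero => simpa using hconj 1
  | succ m ih =>
    have key : z ^ (m + 1 + 1) * y ^ (m + 1 + 1) =
        (z ^ (m + 1) * y ^ (m + 1)) * ((y ^ (m + 1))⁻¹ * (z * y) * y ^ (m + 1)) := by
      rw [pow_succ z (m + 1), pow_succ' y (m + 1)]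
      group
    rw [key]
    exact mul_mem ih (hconj _)

/-- Without generalized torsion, commuting with a positive power of `y` forces commuting
with `y`. -/
theorem Commute.of_zpow_right_of_not_hasGenTorsion {G : Type*} [Group G]
    (hG : ¬ HasGenTorsion G) {x y : G} {m : ℤ} (hm : 0 < m) (h : Commute x (y ^ m)) :
    Commute x y := by
  obtain ⟨k, rfl⟩ : ∃ k : ℕ, m = (k + 1 : ℕ) := ⟨(m - 1).toNat, by lia⟩
  rw [zpow_natCast] at h
  by_contra hxy
  refine hG ⟨x⁻¹ * y⁻¹ * x * y, fun hc => hxy ?_, ?_⟩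
  · have : y * x = x * y := by
      calc y * x = y * x * (x⁻¹ * y⁻¹ * x * y) := by rw [hc, mul_one]
        _ = x * y := by group
    exact this.symm
  · have hz : (x⁻¹ * y⁻¹ * x) ^ (k + 1) * y ^ (k + 1) = 1 := by
      have hpow : (x⁻¹ * y⁻¹ * x) ^ (k + 1) = x⁻¹ * (y⁻¹) ^ (k + 1) * x := by
        simpa using conj_pow (a := x⁻¹) (b := y⁻¹) (i := k + 1)
      rw [hpow, inv_pow, mul_assoc, mul_assoc, ← mul_assoc _ x, h.symm.inv_left.eq]
      group
    exact hz ▸ pow_mul_pow_mem_ggP (x⁻¹ * y⁻¹ * x) y k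

theorem gpq_relations (p q : ℤ) :
    letI a : Gpq p q := PresentedGroup.of 0
    letI b : Gpq p q := PresentedGroup.of 1
    letI t : Gpq p q := PresentedGroup.of 2
    t * a ^ p * t⁻¹ = b⁻¹ * a ^ p ∧ t * (b ^ (-q) * a⁻¹) * t⁻¹ = b ^ (-q) ∧
      Commute (b ^ q) (a ^ p) := by
  refine ⟨?_, ?_, ?_⟩
  · exact mul_inv_eq_one.mp <|
      PresentedGroup.one_of_mem (rels := gpqRels p q) (Or.inl rfl)
  · rw [← mul_assoc]
    exact mul_inv_eq_one.mp <|
      PresentedGroup.one_of_mem (rels := gpqRels p q) (Or.inr (Or.inl rfl))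
  · have h := PresentedGroup.one_of_mem (rels := gpqRels p q) (Or.inr (Or.inr rfl))
    simp only [map_mul, map_inv, map_zpow] at h
    rw [mul_assoc, mul_assoc, inv_mul_eq_one, eq_inv_mul_iff_mul_eq] at h
    exact h.symm

theorem Commute.conj_zpow_of_relations {G : Type*} [Group G] (hG : ¬ HasGenTorsion G)
    {p q : ℤ} (hp : 0 < p) (hq : 0 < q) {a b t : G}
    (hta : t * a ^ p * t⁻¹ = b⁻¹ * a ^ p) (htb : t * (b ^ (-q) * a⁻¹) * t⁻¹ = b ^ (-q))
    {x : G} (hxa : Commute x a) (hxb : Commute x b) (n : ℤ) :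
    Commute (t ^ n * x * (t ^ n)⁻¹) a ∧ Commute (t ^ n * x * (t ^ n)⁻¹) b := by
  have hpos {x y : G} {m : ℤ} (hm : 0 < m) (h : Commute x (y ^ m)) : Commute x y :=
    h.of_zpow_right_of_not_hasGenTorsion hG hm
  have hneg {x y : G} {m : ℤ} (hm : 0 < m) (h : Commute x (y ^ (-m))) : Commute x y := by
    rw [zpow_neg, Commute.inv_right_iff] at h
    exact hpos hm h
  have up {x : G} (h : Commute x a ∧ Commute x b) :
      Commute (t * x * t⁻¹) a ∧ Commute (t * x * t⁻¹) b := by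
    have h₁ : Commute (t * x * t⁻¹) (b⁻¹ * a ^ p) :=
      hta ▸ (Commute.conj_iff t).mpr (h.1.zpow_right p)
    have h₂ : Commute (t * x * t⁻¹) (b ^ (-q)) :=
      htb ▸ (Commute.conj_iff t).mpr ((h.2.zpow_right (-q)).mul_right h.1.inv_right)
    have hb := hneg hq h₂
    refine ⟨hpos hp ?_, hb⟩
    simpa using hb.mul_right h₁
  have down {x : G} (h : Commute x a ∧ Commute x b) :
      Commute (t⁻¹ * x * t) a ∧ Commute (t⁻¹ * x * t) b := by
    have hx : t * (t⁻¹ * x * t) * t⁻¹ = x := by group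
    have h₁ : Commute (t⁻¹ * x * t) (a ^ p) := by
      rw [← Commute.conj_iff t, hx, hta]
      exact h.2.inv_right.mul_right (h.1.zpow_right p)
    have h₂ : Commute (t⁻¹ * x * t) (b ^ (-q) * a⁻¹) := by
      rw [← Commute.conj_iff t, hx, htb]
      exact h.2.zpow_right (-q)
    have ha := hpos hp h₁
    refine ⟨ha, hneg hq ?_⟩
    simpa using h₂.mul_right ha
  induction n using Int.induction_on with
  | zero => simpa using ⟨hxa, hxb⟩
  | succ n ih =>
    have e : t ^ ((n : ℤ) + 1) * x * (t ^ ((n : ℤ) + 1))⁻¹ =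
        t * (t ^ (n : ℤ) * x * (t ^ (n : ℤ))⁻¹) * t⁻¹ := by
      rw [add_comm, zpow_one_add]
      group
    rw [e]
    exact up ih
  | pred n ih =>
    have e : t ^ (-(n : ℤ) - 1) * x * (t ^ (-(n : ℤ) - 1))⁻¹ =
        t⁻¹ * (t ^ (-(n : ℤ)) * x * (t ^ (-(n : ℤ)))⁻¹) * t := by
      rw [sub_eq_neg_add, zpow_add, zpow_neg_one]
      group
    rw [e]
    exact down ih

/-- if `p, q > 0` and `G_{p,q}` has no generalized torsion elements, then
`[b, t^{-n} b t^n] = 1` in `G_{p,q}` for every integer `n`. -/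
theorem commutes_with_conjugates (p q : ℤ) (hp : 0 < p) (hq : 0 < q)
    (hng : ¬ HasGenTorsion (Gpq p q)) :
    ∀ n : ℤ,
      letI b : Gpq p q := PresentedGroup.of 1
      letI t : Gpq p q := PresentedGroup.of 2
      b⁻¹ * (t ^ (-n) * b * t ^ n)⁻¹ * b * (t ^ (-n) * b * t ^ n) = 1 := by
  intro n
  obtain ⟨hta, htb, hab⟩ := gpq_relations p q
  have hba : Commute (PresentedGroup.of 1 : Gpq p q) (PresentedGroup.of 0) :=
    ((hab.of_zpow_right_of_not_hasGenTorsion hng hp).symm.of_zpow_right_of_not_hasGenTorsion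
      hng hq).symm
  have h := (Commute.conj_zpow_of_relations hng hp hq hta htb hba (Commute.refl _) (-n)).2
  rw [← zpow_neg, neg_neg] at h
  rw [mul_assoc, mul_assoc, inv_mul_eq_one, eq_inv_mul_iff_mul_eq]
  exact h.eq
end
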